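/- Let μ : ℤ → ℝ be the sequence with μ(−1) = 1/4, μ(0) = 1/2, μ(1) = 1/4 and μ(n) = 0 otherwise, and let ν : ℤ → ℝ be given by ν(n) = 2·|n|·(−1)^{|n|+1}. Then for every m ∈ ℤ, Σ_{k ∈ ℤ} μ(k) · ν(m − k) equals 1 if m = 0 and equals 0 otherwise; that is, μ ∗ ν = δ₀ as sequences on ℤ. -/

import Mathlib

/-- The measure `μ = 1/4 δ₋₁ + 1/2 δ₀ + 1/4 δ₁` as a sequence on `ℤ`. -/
noncomputable def muSeq : ℤ → ℝ := fun n =>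
  if n = -1 then 1 / 4 else if n = 0 then 1 / 2 else if n = 1 then 1 / 4 else 0

/-- The strange inverse `ν` with `ν(n) = 2|n|(-1)^{|n|+1}`. -/
noncomputable def nuSeq : ℤ → ℝ := fun n => 2 * (n.natAbs : ℝ) * (-1) ^ (n.natAbs + 1)

theorem nuSeq_neg (n : ℤ) : nuSeq (-n) = nuSeq n := by
  simp [nuSeq]

theorem nuSeq_natCast (n : ℕ) : nuSeq n = 2 * (n : ℝ) * (-1) ^ (n + 1) := by
  simp [nuSeq]

theorem finsum_muSeq_mul (b : ℤ → ℝ) :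
    ∑ᶠ k : ℤ, muSeq k * b k = 1 / 4 * b (-1) + 1 / 2 * b 0 + 1 / 4 * b 1 := by
  rw [finsum_eq_sum_of_support_subset (s := {-1, 0, 1})]
  · simp [muSeq, add_assoc]
  · intro k hk
    contrapose! hk
    simp_all [muSeq]

/-- Three-term recurrence satisfied by `nuSeq` at positive integers. -/
theorem nuSeq_recurrence (n : ℕ) :
    1 / 4 * nuSeq (n + 2) + 1 / 2 * nuSeq (n + 1) + 1 / 4 * nuSeq n = 0 := by
  have h₁ := nuSeq_natCast (n + 1)
  have h₂ := nuSeq_natCast (n + 2)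
  push_cast at h₁ h₂
  rw [h₁, h₂, nuSeq_natCast]
  ring

/-- `μ ∗ ν = δ₀` as sequences on `ℤ`. -/
theorem muSeq_conv_nuSeq (m : ℤ) :
    ∑ᶠ k : ℤ, muSeq k * nuSeq (m - k) = if m = 0 then 1 else 0 := by
  rw [finsum_muSeq_mul fun k => nuSeq (m - k)]
  rcases lt_trichotomy m 0 with hm | rfl | hm
  · obtain ⟨n, rfl⟩ : ∃ n : ℕ, m = -(n + 1) := ⟨(-m - 1).toNat, by lia⟩
    rw [if_neg hm.ne, ← nuSeq_recurrence n, ← nuSeq_neg (n + 2), ← nuSeq_neg (n + 1),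
      ← nuSeq_neg n]
    ring_nf
  · norm_num [nuSeq]
  · obtain ⟨n, rfl⟩ : ∃ n : ℕ, m = n + 1 := ⟨(m - 1).toNat, by lia⟩
    rw [if_neg hm.ne', ← nuSeq_recurrence n]
    ring_nf
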